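/- Let (X, μ) be a measure space and let p, q : X → ℝ be measurable, nonnegative functions with ∫ p dμ = ∫ q dμ = 1. Assume q(x) = 0 for μ-a.e. x with p(x) = 0, and set c := ∫ √(p q) dμ, g(x) := √(q(x)/p(x)) − c (with the convention q(x)/p(x) := 0 when p(x) = 0). Let u, v : X → ℝ be measurable with ∫ u² p dμ < ∞ and ∫ v² p dμ < ∞, and set ū := u − ∫ u p dμ and v̄ := v − ∫ v p dμ. Then (∫ g ū p dμ) · (∫ g v̄ p dμ) ≤ (1 − c²) (∫ ū² p dμ)^{1/2} (∫ v̄² p dμ)^{1/2}. -/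

import Mathlib

open MeasureTheory

/-- The product of two functions that are square integrable against a nonnegative weight is
integrable against that weight. -/
lemma integrable_mul_mul_weight {X : Type*} [MeasurableSpace X] {μ : Measure X} {w f h : X → ℝ}
    (hw : Measurable w) (hw0 : ∀ x, 0 ≤ w x) (hf : Measurable f) (hh : Measurable h)
    (hf2 : Integrable (fun x => f x ^ 2 * w x) μ) (hh2 : Integrable (fun x => h x ^ 2 * w x) μ) :
    Integrable (fun x => f x * h x * w x) μ := by
  refine (hf2.add hh2).mono' ((hf.mul hh).mul hw).aestronglyMeasurable (ae_of_all _ fun x => ?_)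
  simp only [Pi.add_apply, Real.norm_eq_abs, abs_mul, abs_of_nonneg (hw0 x), ← add_mul]
  refine mul_le_mul_of_nonneg_right ?_ (hw0 x)
  nlinarith [sq_nonneg (|f x| - |h x|), sq_abs (f x), sq_abs (h x), sq_nonneg (f x),
    sq_nonneg (h x)]

/-- The Cauchy–Schwarz inequality for integrals against a nonnegative weight. -/
lemma abs_integral_mul_mul_weight_le {X : Type*} [MeasurableSpace X] {μ : Measure X}
    {w f h : X → ℝ} (hw : Measurable w) (hw0 : ∀ x, 0 ≤ w x) (hf : Measurable f)
    (hh : Measurable h) (hf2 : Integrable (fun x => f x ^ 2 * w x) μ)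
    (hh2 : Integrable (fun x => h x ^ 2 * w x) μ) :
    |∫ x, f x * h x * w x ∂μ|
      ≤ √(∫ x, f x ^ 2 * w x ∂μ) * √(∫ x, h x ^ 2 * w x ∂μ) := by
  have hfh := integrable_mul_mul_weight hw hw0 hf hh hf2 hh2
  have hquad (t : ℝ) : 0 ≤ (∫ x, f x ^ 2 * w x ∂μ) * (t * t)
      + (2 * ∫ x, f x * h x * w x ∂μ) * t + ∫ x, h x ^ 2 * w x ∂μ := by
    have hnonneg : 0 ≤ ∫ x, (t * f x + h x) ^ 2 * w x ∂μ :=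
      integral_nonneg fun x => mul_nonneg (sq_nonneg _) (hw0 x)
    have hexpand (x : X) : (t * f x + h x) ^ 2 * w x
        = (t * t) * (f x ^ 2 * w x) + (2 * t) * (f x * h x * w x) + h x ^ 2 * w x := by
      ring
    simp_rw [hexpand] at hnonneg
    rw [integral_add ((hf2.const_mul _).fun_add (hfh.const_mul _)) hh2,
      integral_add (hf2.const_mul _) (hfh.const_mul _), integral_const_mul,
      integral_const_mul] at hnonneg
    linarith
  have hdiscrim := discrim_le_zero hquad
  rw [discrim] at hdiscrim
  rw [← Real.sqrt_mul (integral_nonneg fun x => mul_nonneg (sq_nonneg _) (hw0 x))]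
  exact Real.abs_le_sqrt (by linarith)

/-- Centering with respect to an integrable weight preserves square integrability. -/
lemma integrable_sub_const_sq_mul_weight {X : Type*} [MeasurableSpace X] {μ : Measure X}
    {w f : X → ℝ} (hw : Measurable w) (hw0 : ∀ x, 0 ≤ w x) (hwint : Integrable w μ)
    (hf : Measurable f) (hf2 : Integrable (fun x => f x ^ 2 * w x) μ) (a : ℝ) :
    Integrable (fun x => (f x - a) ^ 2 * w x) μ := by
  have hfw : Integrable (fun x => f x * 1 * w x) μ :=
    integrable_mul_mul_weight hw hw0 hf measurable_const hf2 (by simpa using hwint)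
  refine ((hf2.sub (hfw.const_mul (2 * a))).add (hwint.const_mul (a ^ 2))).congr
    (ae_of_all _ fun x => ?_)
  simp only [Pi.add_apply, Pi.sub_apply]
  ring

/-- Pointwise expansion of the squared centered density ratio, weighted by the density. -/
lemma sqrt_div_sub_sq_mul {a b : ℝ} (ha : 0 ≤ a) (hb : 0 ≤ b) (hab : a = 0 → b = 0) (c : ℝ) :
    (√(b / a) - c) ^ 2 * a = b - 2 * c * √(a * b) + c ^ 2 * a := by
  rcases ha.eq_or_lt with rfl | ha'
  · simp [hab rfl]
  · have hroot : √(a * b) = √(b / a) * a := by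
      rw [show a * b = b / a * a ^ 2 by field_simp, Real.sqrt_mul (by positivity),
        Real.sqrt_sq ha]
    have hsq : √(b / a) ^ 2 * a = b := by
      rw [Real.sq_sqrt (by positivity), div_mul_cancel₀ _ ha'.ne']
    rw [hroot]
    linear_combination hsq

/-- Cauchy–Schwarz-type bound in the Fisher–Rao geometry:
with `c = ∫ √(pq)`, `g = √(q/p) − c`, and centered functions `ū, v̄`,
`(∫ g ū p)(∫ g v̄ p) ≤ (1 − c²) (∫ ū² p)^{1/2} (∫ v̄² p)^{1/2}`. -/
theorem fisher_rao_cauchy_schwarz_bound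
    {X : Type*} [MeasurableSpace X] (μ : Measure X)
    (p q : X → ℝ) (hp : Measurable p) (hq : Measurable q)
    (hp0 : ∀ x, 0 ≤ p x) (hq0 : ∀ x, 0 ≤ q x)
    (hpint : ∫ x, p x ∂μ = 1) (hqint : ∫ x, q x ∂μ = 1)
    (habs : ∀ᵐ x ∂μ, p x = 0 → q x = 0)
    (c : ℝ) (hc : c = ∫ x, Real.sqrt (p x * q x) ∂μ)
    (g : X → ℝ) (hg : ∀ x, g x = Real.sqrt (q x / p x) - c)
    (u v : X → ℝ) (hu : Measurable u) (hv : Measurable v)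
    (husq : Integrable (fun x => u x ^ 2 * p x) μ)
    (hvsq : Integrable (fun x => v x ^ 2 * p x) μ)
    (ubar : X → ℝ) (hubar : ∀ x, ubar x = u x - ∫ y, u y * p y ∂μ)
    (vbar : X → ℝ) (hvbar : ∀ x, vbar x = v x - ∫ y, v y * p y ∂μ) :
    (∫ x, g x * ubar x * p x ∂μ) * (∫ x, g x * vbar x * p x ∂μ)
      ≤ (1 - c ^ 2) * Real.sqrt (∫ x, ubar x ^ 2 * p x ∂μ)
          * Real.sqrt (∫ x, vbar x ^ 2 * p x ∂μ) := by
  have hpI : Integrable p μ := .of_integral_ne_zero (by simp [hpint])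
  have hqI : Integrable q μ := .of_integral_ne_zero (by simp [hqint])
  have hrootI : Integrable (fun x => √(p x * q x)) μ := by
    refine (hpI.add hqI).mono' (hp.mul hq).sqrt.aestronglyMeasurable (ae_of_all _ fun x => ?_)
    rw [Real.norm_of_nonneg (Real.sqrt_nonneg _), Pi.add_apply]
    refine Real.sqrt_le_iff.mpr ⟨add_nonneg (hp0 x) (hq0 x), ?_⟩
    nlinarith [hp0 x, hq0 x, mul_nonneg (hp0 x) (hq0 x)]
  have hg2 : (fun x => g x ^ 2 * p x)
      =ᵐ[μ] fun x => q x - 2 * c * √(p x * q x) + c ^ 2 * p x := by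
    filter_upwards [habs] with x hx
    rw [hg, sqrt_div_sub_sq_mul (hp0 x) (hq0 x) hx]
  have hdiffI : Integrable (fun x => q x - 2 * c * √(p x * q x)) μ :=
    hqI.sub (hrootI.const_mul _)
  have hg2I : Integrable (fun x => g x ^ 2 * p x) μ :=
    (hdiffI.add (hpI.const_mul _)).congr hg2.symm
  have hg2int : ∫ x, g x ^ 2 * p x ∂μ = 1 - c ^ 2 := by
    rw [integral_congr_ae hg2, integral_add hdiffI (hpI.const_mul _),
      integral_sub hqI (hrootI.const_mul _), integral_const_mul, integral_const_mul, hpint, hqint,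
      ← hc]
    ring
  have hgm : Measurable g := by
    rw [funext hg]
    exact (hq.div hp).sqrt.sub_const c
  have hum : Measurable ubar := by
    rw [funext hubar]
    exact hu.sub_const _
  have hvm : Measurable vbar := by
    rw [funext hvbar]
    exact hv.sub_const _
  have hu2I : Integrable (fun x => ubar x ^ 2 * p x) μ := by
    simpa only [hubar] using integrable_sub_const_sq_mul_weight hp hp0 hpI hu husq _
  have hv2I : Integrable (fun x => vbar x ^ 2 * p x) μ := by
    simpa only [hvbar] using integrable_sub_const_sq_mul_weight hp hp0 hpI hv hvsq _
  have hub := abs_integral_mul_mul_weight_le hp hp0 hgm hum hg2I hu2I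
  have hvb := abs_integral_mul_mul_weight_le hp hp0 hgm hvm hg2I hv2I
  have hc1 : 0 ≤ 1 - c ^ 2 :=
    hg2int ▸ integral_nonneg fun x => mul_nonneg (sq_nonneg _) (hp0 x)
  rw [hg2int] at hub hvb
  calc _ ≤ |∫ x, g x * ubar x * p x ∂μ| * |∫ x, g x * vbar x * p x ∂μ| :=
        (le_abs_self _).trans_eq (abs_mul _ _)
    _ ≤ (√(1 - c ^ 2) * √(∫ x, ubar x ^ 2 * p x ∂μ))
        * (√(1 - c ^ 2) * √(∫ x, vbar x ^ 2 * p x ∂μ)) := by gcongr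
    _ = _ := by
      nth_rewrite 3 [← Real.mul_self_sqrt hc1]
      ring
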